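/- Let L be a finitely generated abelian group, M an abelian group, N₀ and N₁ subgroups of ℚ, and let N be the subgroup of ℚ generated by N₀ ∪ N₁. Then for every group homomorphism ξ : L → M ⊗_ℤ N there exist group homomorphisms ξ₀ : L → M ⊗_ℤ N₀ and ξ₁ : L → M ⊗_ℤ N₁ such that ξ = ι₁ ∘ ξ₁ − ι₀ ∘ ξ₀, where ιⱼ : M ⊗_ℤ Nⱼ → M ⊗_ℤ N denotes the homomorphism induced by the inclusion Nⱼ ↪ N. -/

import Mathlib

open TensorProduct

/-- A linear map from a finitely presented module to `N ⊗ M` factors through `P ⊗ M` for some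
finitely generated submodule `P` of `N`. -/
theorem Module.FinitePresentation.exists_fg_rTensor_factorization {R L M N : Type*} [CommRing R]
    [AddCommGroup L] [Module R L] [Module.FinitePresentation R L]
    [AddCommGroup M] [Module R M] [AddCommGroup N] [Module R N] (ξ : L →ₗ[R] N ⊗[R] M) :
    ∃ P : Submodule R N, P.FG ∧ ∃ η : L →ₗ[R] P ⊗[R] M, P.subtype.rTensor M ∘ₗ η = ξ := by
  obtain ⟨n, m, f, g, hf, hfg⟩ := Module.FinitePresentation.exists_fin' R L
  obtain ⟨P, hP, hr⟩ := TensorProduct.exists_finite_submodule_left_of_setFinite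
    (Set.range fun i ↦ ξ (f (Pi.basisFun R (Fin n) i))) (Set.finite_range _)
  choose c hc using fun i ↦ hr ⟨i, rfl⟩
  have hPfg : P.FG := Module.Finite.iff_fg.mp hP
  let φ : (Fin n → R) →ₗ[R] P ⊗[R] M := (Pi.basisFun R (Fin n)).constr R c
  have hφ : P.subtype.rTensor M ∘ₗ φ = ξ ∘ₗ f := by
    refine (Pi.basisFun R (Fin n)).ext fun i ↦ ?_
    simp only [φ, LinearMap.comp_apply, Module.Basis.constr_basis, hc]
  have hzero (j : Fin m) :
      P.subtype.rTensor M (φ (g (Pi.basisFun R (Fin m) j))) = 0 := by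
    have := LinearMap.congr_fun hφ (g (Pi.basisFun R (Fin m) j))
    simp only [LinearMap.comp_apply] at this
    rw [this, hfg.apply_apply_eq_zero, map_zero]
  choose Q hPQ hQ hQ0 using fun j ↦
    TensorProduct.eq_zero_of_fg_of_subtype_eq_zero hPfg (hzero j)
  let S : Submodule R N := P ⊔ ⨆ j, Q j
  have hPS : P ≤ S := le_sup_left
  let ψ : (Fin n → R) →ₗ[R] S ⊗[R] M := (Submodule.inclusion hPS).rTensor M ∘ₗ φ
  have hψg : ψ ∘ₗ g = 0 := by
    refine (Pi.basisFun R (Fin m)).ext fun j ↦ ?_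
    have hQS : Q j ≤ S := (le_iSup Q j).trans le_sup_right
    have : Submodule.inclusion hPS = Submodule.inclusion hQS ∘ₗ Submodule.inclusion (hPQ j) := rfl
    simp only [ψ, this, LinearMap.rTensor_comp, LinearMap.comp_apply, hQ0, map_zero,
      LinearMap.zero_apply]
  have hker : LinearMap.ker f ≤ LinearMap.ker ψ := by
    rw [hfg.linearMap_ker_eq]
    exact LinearMap.range_le_ker_iff.mpr hψg
  refine ⟨S, hPfg.sup (Submodule.fg_iSup _ hQ),
    (LinearMap.ker f).liftQ ψ hker ∘ₗ (f.quotKerEquivOfSurjective hf).symm, ?_⟩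
  refine (LinearMap.cancel_right hf).mp ?_
  ext1 i
  rw [← hφ]
  ext
  have (x : Fin n → R) : (f.quotKerEquivOfSurjective hf).symm (f x) = (LinearMap.ker f).mkQ x := by
    rw [LinearEquiv.symm_apply_eq]
    rfl
  simp only [LinearMap.comp_apply, LinearEquiv.coe_coe, this, Submodule.mkQ_apply,
    Submodule.liftQ_apply, ψ]
  rw [← LinearMap.comp_apply, ← LinearMap.rTensor_comp]
  rfl

/-- Over a principal ideal domain, a surjection onto a torsion-free module remains surjective after
tensoring with any module and applying `Hom(L, -)` with `L` finitely presented. -/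
theorem Module.FinitePresentation.exists_lift_rTensor {R L M N A : Type*} [CommRing R]
    [IsDomain R] [IsPrincipalIdealRing R]
    [AddCommGroup L] [Module R L] [Module.FinitePresentation R L]
    [AddCommGroup M] [Module R M] [AddCommGroup N] [Module R N] [Module.IsTorsionFree R N]
    [AddCommGroup A] [Module R A] (g : A →ₗ[R] N) (hg : Function.Surjective g)
    (ξ : L →ₗ[R] N ⊗[R] M) : ∃ η : L →ₗ[R] A ⊗[R] M, g.rTensor M ∘ₗ η = ξ := by
  obtain ⟨P, hP, η, rfl⟩ := exists_fg_rTensor_factorization ξ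
  have : Module.Finite R P := Module.Finite.iff_fg.mpr hP
  have : Module.Free R P := Module.free_of_finite_type_torsion_free'
  obtain ⟨s, hs⟩ := Module.projective_lifting_property g P.subtype hg
  exact ⟨s.rTensor M ∘ₗ η, by rw [← LinearMap.comp_assoc, ← LinearMap.rTensor_comp, hs]⟩

/-- If `L` is a finitely generated abelian group, `M` an abelian group,
`N₀, N₁` subgroups of `ℚ` and `N = N₀ ⊔ N₁` the subgroup generated by them, then every
homomorphism `ξ : L → M ⊗_ℤ N` decomposes as `ξ = ι₁ ∘ ξ₁ - ι₀ ∘ ξ₀`. -/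
theorem stmt0 (L M : Type*) [AddCommGroup L] [AddCommGroup M] [AddGroup.FG L]
    (N₀ N₁ : AddSubgroup ℚ)
    (ξ : L →+ M ⊗[ℤ] ↥(N₀ ⊔ N₁)) :
    ∃ (ξ₀ : L →+ M ⊗[ℤ] ↥N₀) (ξ₁ : L →+ M ⊗[ℤ] ↥N₁),
      ξ = ((LinearMap.lTensor M
              (AddSubgroup.inclusion (le_sup_right : N₁ ≤ N₀ ⊔ N₁)).toIntLinearMap
            ).toAddMonoidHom.comp ξ₁)
        - ((LinearMap.lTensor M
              (AddSubgroup.inclusion (le_sup_left : N₀ ≤ N₀ ⊔ N₁)).toIntLinearMap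
            ).toAddMonoidHom.comp ξ₀) := by
  let i₀ := (AddSubgroup.inclusion (le_sup_left : N₀ ≤ N₀ ⊔ N₁)).toIntLinearMap
  let i₁ := (AddSubgroup.inclusion (le_sup_right : N₁ ≤ N₀ ⊔ N₁)).toIntLinearMap
  let ξ' : L →ₗ[ℤ] M ⊗[ℤ] ↥(N₀ ⊔ N₁) :=
    { toFun := ξ, map_add' := map_add ξ, map_smul' := map_zsmul ξ }
  have : Module.Finite ℤ L := Module.Finite.iff_addGroup_fg.mpr ‹_›
  have : Module.FinitePresentation ℤ L := Module.finitePresentation_of_finite ℤ L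
  have hg : Function.Surjective (i₁.coprod (-i₀)) := by
    rintro ⟨x, hx⟩
    obtain ⟨y, hy, z, hz, rfl⟩ := AddSubgroup.mem_sup.mp hx
    refine ⟨(⟨z, hz⟩, ⟨-y, neg_mem hy⟩), Subtype.ext ?_⟩
    simp [i₀, i₁, add_comm]
  obtain ⟨η, hη⟩ := Module.FinitePresentation.exists_lift_rTensor (i₁.coprod (-i₀)) hg
    ((TensorProduct.comm ℤ M _).toLinearMap ∘ₗ ξ')
  let ζ := (TensorProduct.comm ℤ _ M).toLinearMap ∘ₗ η
  have hζ : (i₁.coprod (-i₀)).lTensor M ∘ₗ ζ = ξ' := by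
    ext x
    apply (TensorProduct.comm ℤ M _).injective
    refine Eq.trans ?_ (LinearMap.congr_fun hη x)
    simp [ζ, LinearMap.lTensor, LinearMap.rTensor, TensorProduct.map_comm]
  refine ⟨((LinearMap.snd ℤ N₁ N₀).lTensor M ∘ₗ ζ).toAddMonoidHom,
    ((LinearMap.fst ℤ N₁ N₀).lTensor M ∘ₗ ζ).toAddMonoidHom, ?_⟩
  have hsplit : i₁.coprod (-i₀) = i₁ ∘ₗ LinearMap.fst ℤ N₁ N₀ - i₀ ∘ₗ LinearMap.snd ℤ N₁ N₀ := by
    ext <;> simp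
  rw [hsplit, LinearMap.lTensor_sub, LinearMap.lTensor_comp, LinearMap.lTensor_comp] at hζ
  ext x
  exact (LinearMap.congr_fun hζ x).symm
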